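/- arXiv:2311.09906 — 2 statements merged into one kernel-verified Lean document; each statement's English description precedes it below -/
import Mathlib

section
/- Let g be a finite-dimensional unimodular real Lie algebra of dimension 2n containing an abelian ideal a of codimension 2, and J a complex structure on g with J(a) ≠ a and [g,g] ⊄ a. Assume J is generic, i.e. [J𝔟,𝔟] ⊄ 𝔟. If (g,J) admits a pluriclosed Hermitian metric, then σb < 0 for every choice of x ∈ 𝔟 \ a_J and y ∈ a with a = a_J ⊕ ℝx ⊕ ℝy, where σ, b are determined by [Jx,Jy] − σ·Jx ∈ a_J and [Jx,x] − (ax+by) ∈ a_J. In particular, (g,J) admits no balanced Hermitian metric. -/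
open Module

section Defs

variable {L : Type*} [LieRing L] [LieAlgebra ℝ L]

/-- A complex structure on a real Lie algebra: `J² = -id` plus integrability. -/
def IsComplexStructure (J : L →ₗ[ℝ] L) : Prop :=
  (∀ x : L, J (J x) = -x) ∧
  (∀ x y : L, ⁅x, y⁆ - ⁅J x, J y⁆ + J ⁅J x, y⁆ + J ⁅x, J y⁆ = 0)

/-- A Lie algebra is unimodular if every `ad x` is traceless. -/
def IsUnimodularLie (L : Type*) [LieRing L] [LieAlgebra ℝ L] : Prop :=
  ∀ x : L, LinearMap.trace ℝ L (LieAlgebra.ad ℝ L x) = 0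

/-- A Hermitian metric on `(L, J)`: a `J`-compatible inner product. -/
structure HermMetric (J : L →ₗ[ℝ] L) : Type _ where
  B : L →ₗ[ℝ] L →ₗ[ℝ] ℝ
  symm : ∀ x y : L, B x y = B y x
  posdef : ∀ x : L, x ≠ 0 → 0 < B x x
  compat : ∀ x y : L, B (J x) (J y) = B x y

variable {J : L →ₗ[ℝ] L}

/-- The Kähler form `ω(x,y) = ⟨Jx, y⟩`. -/
def HermMetric.omega (g : HermMetric J) (x y : L) : ℝ := g.B (J x) y

/-- Exterior differential of the Kähler form. -/
def HermMetric.dOmega (g : HermMetric J) (x y z : L) : ℝ :=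
  - g.omega ⁅x, y⁆ z + g.omega ⁅x, z⁆ y - g.omega ⁅y, z⁆ x

/-- `dᶜω (x,y,z) = -dω(Jx, Jy, Jz)`. -/
def HermMetric.dcOmega (g : HermMetric J) (x y z : L) : ℝ :=
  - g.dOmega (J x) (J y) (J z)

/-- `d(dᶜω)` as a 4-form. -/
def HermMetric.ddcOmega (g : HermMetric J) (x y z w : L) : ℝ :=
  - g.dcOmega ⁅x, y⁆ z w + g.dcOmega ⁅x, z⁆ y w - g.dcOmega ⁅x, w⁆ y z
  - g.dcOmega ⁅y, z⁆ x w + g.dcOmega ⁅y, w⁆ x z - g.dcOmega ⁅z, w⁆ x y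

/-- The metric is Kähler if `dω = 0`. -/
def HermMetric.IsKahler (g : HermMetric J) : Prop :=
  ∀ x y z : L, g.dOmega x y z = 0

/-- The metric is pluriclosed if `d(dᶜω) = 0`. -/
def HermMetric.IsPluriclosed (g : HermMetric J) : Prop :=
  ∀ x y z w : L, g.ddcOmega x y z w = 0

/-- The metric is balanced (dimension `2n`): for every orthonormal basis `f`,
`Σ_k dω(f_k, J f_k, x) = 0` for all `x`. -/
def HermMetric.IsBalanced (g : HermMetric J) (n : ℕ) : Prop :=
  ∀ f : Basis (Fin (2 * n)) ℝ L,
    (∀ i j, g.B (f i) (f j) = if i = j then 1 else 0) →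
    ∀ x : L, (∑ k, g.dOmega (f k) (J (f k)) x) = 0

end Defs

/-- Additivity of the trace along an invariant subspace. -/
theorem trace_eq_trace_restrict_add_trace_mapQ {K V : Type*} [Field K] [AddCommGroup V]
    [Module K V] [FiniteDimensional K V] (W : Submodule K V) (e : V →ₗ[K] V)
    (he : W ≤ W.comap e) :
    LinearMap.trace K V e =
      LinearMap.trace K W (e.restrict he) + LinearMap.trace K (V ⧸ W) (W.mapQ W e he) := by
  let bW := Free.chooseBasis K W
  let bQ := Free.chooseBasis K (V ⧸ W)
  rw [LinearMap.trace_eq_matrix_trace K (Basis.sumQuot bW bQ),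
    LinearMap.trace_eq_matrix_trace K bW, LinearMap.trace_eq_matrix_trace K bQ]
  simp only [Matrix.trace, Matrix.diag, Fintype.sum_sum_type, LinearMap.toMatrix_apply]
  congr 1
  · refine Finset.sum_congr rfl fun i _ => ?_
    rw [Basis.sumQuot_inl, Basis.sumQuot_repr_inl_of_mem]
    rfl
  · refine Finset.sum_congr rfl fun j _ => ?_
    rw [Basis.sumQuot_repr_inr, ← Basis.sumQuot_inr bW bQ j, Submodule.mapQ_apply]
    rfl

section PosDef

variable {V : Type*} [AddCommGroup V] [Module ℝ V]

/-- A positive definite symmetric bilinear form admits an orthonormal basis. -/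
theorem exists_basis_of_posDef [FiniteDimensional ℝ V] (B : V →ₗ[ℝ] V →ₗ[ℝ] ℝ)
    (hs : ∀ x y, B x y = B y x) (hp : ∀ x, x ≠ 0 → 0 < B x x) {n : ℕ} (hn : finrank ℝ V = n) :
    ∃ b : Basis (Fin n) ℝ V, ∀ i j, B (b i) (b j) = if i = j then 1 else 0 := by
  let core : InnerProductSpace.Core ℝ V :=
    { inner := fun x y => B x y
      conj_inner_symm := fun x y => hs y x
      re_inner_nonneg := fun x => by
        rcases eq_or_ne x 0 with rfl | hx
        · simp
        · exact (hp x hx).le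
      add_left := fun x y z => by simp
      smul_left := fun x y r => by simp
      definite := fun x hx => by
        by_contra h
        exact (hp x h).ne' hx }
  let _ : NormedAddCommGroup V := core.toNormedAddCommGroup
  let _ : InnerProductSpace ℝ V := InnerProductSpace.ofCore core.toCore
  refine ⟨((stdOrthonormalBasis ℝ V).reindex (finCongr hn)).toBasis, fun i j => ?_⟩
  rw [OrthonormalBasis.coe_toBasis]
  exact orthonormal_iff_ite.mp ((stdOrthonormalBasis ℝ V).reindex (finCongr hn)).orthonormal i j

/-- The trace computed in an orthonormal basis. -/
theorem trace_eq_sum_of_orthonormal (B : V →ₗ[ℝ] V →ₗ[ℝ] ℝ) {n : ℕ} (b : Basis (Fin n) ℝ V)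
    (hb : ∀ i j, B (b i) (b j) = if i = j then 1 else 0) (T : V →ₗ[ℝ] V) :
    LinearMap.trace ℝ V T = ∑ i, B (T (b i)) (b i) := by
  rw [LinearMap.trace_eq_matrix_trace ℝ b]
  refine Finset.sum_congr rfl fun i _ => ?_
  rw [Matrix.diag_apply, LinearMap.toMatrix_apply]
  have h := congrArg (fun v => B v (b i)) (b.sum_repr (T (b i)))
  simp only [map_sum, LinearMap.sum_apply, map_smul, LinearMap.smul_apply, hb] at h
  simpa using h

end PosDef

/-- A real vector space carrying a complex structure has even dimension. -/
theorem even_finrank_of_sq_eq_neg {V : Type*} [AddCommGroup V] [Module ℝ V] (J : V →ₗ[ℝ] V)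
    (hJ : ∀ x, J (J x) = -x) : Even (finrank ℝ V) := by
  have h : J ∘ₗ J = (-1 : ℝ) • LinearMap.id := by ext x; simp [hJ]
  have hd := congrArg LinearMap.det h
  rw [LinearMap.det_comp, LinearMap.det_smul, LinearMap.det_id, mul_one] at hd
  by_contra hodd
  rw [Nat.not_even_iff_odd] at hodd
  rw [hodd.neg_one_pow] at hd
  nlinarith [mul_self_nonneg (LinearMap.det J)]

section Model

variable {Q : Type*} [LieRing Q] [LieAlgebra ℝ Q]

/-- The Jacobi identity determines the remaining brackets of the four-dimensional model algebra. -/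
theorem model_brackets {X Y X' Y' : Q} {σ c e d f : ℝ} (hσ : σ ≠ 0)
    (hX'X : ⁅X', X⁆ = Y) (hX'Y' : ⁅X', Y'⁆ = σ • X') (hY'X : ⁅Y', X⁆ = ⁅X', Y⁆ - σ • X)
    (hX'Y : ⁅X', Y⁆ = c • X + e • Y) (hY'Y : ⁅Y', Y⁆ = d • X + f • Y)
    (hli : ∀ s t : ℝ, s • X + t • Y = 0 → s = 0 ∧ t = 0) :
    ⁅X', Y⁆ = 0 ∧ ⁅Y', X⁆ = -σ • X ∧ ⁅Y', Y⁆ = (-2 * σ) • Y := by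
  have h1 : (c * e - d) • X + (c - σ + e * e - f - σ) • Y = 0 := by
    have h := lie_lie X' Y' X
    rw [hX'Y', hX'X, hY'X, hX'Y, hY'Y, smul_lie, hX'X] at h
    simp only [lie_add, lie_sub, lie_smul, hX'X, hX'Y] at h
    linear_combination (norm := module) -h
  have h2 : (c * f - c * (c - σ) - d * e - σ * c) • X + (d - c * e - σ * e) • Y = 0 := by
    have h := lie_lie X' Y' Y
    rw [hX'Y', hX'Y, hY'Y, smul_lie, hX'Y] at h
    simp only [lie_add, lie_smul, hX'X, hX'Y, hY'X, hY'Y] at h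
    linear_combination (norm := module) -h
  obtain ⟨h11, h12⟩ := hli _ _ h1
  obtain ⟨h21, h22⟩ := hli _ _ h2
  have he : e = 0 := by
    have : σ * e = 0 := by linarith
    exact (mul_eq_zero.mp this).resolve_left hσ
  subst he
  have hd : d = 0 := by linarith
  subst hd
  have hf : f = c - 2 * σ := by linarith
  subst hf
  have hc : c = 0 := by
    have : σ * c = 0 := by linarith
    exact (mul_eq_zero.mp this).resolve_left hσ
  subst hc
  refine ⟨by rw [hX'Y]; module, by rw [hY'X, hX'Y]; module, by rw [hY'Y]; module⟩

/-- The bracket relations, in a basis `X, Y, JX, JY`, of the quotient of the Lie algebra by the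
maximal complex subspace of its abelian ideal. -/
structure IsModelBasis (b : Basis (Fin 4) ℝ Q) (σ : ℝ) : Prop where
  lie_zero_one : ⁅b 0, b 1⁆ = 0
  lie_two_zero : ⁅b 2, b 0⁆ = b 1
  lie_two_one : ⁅b 2, b 1⁆ = 0
  lie_three_zero : ⁅b 3, b 0⁆ = -σ • b 0
  lie_three_one : ⁅b 3, b 1⁆ = (-2 * σ) • b 1
  lie_two_three : ⁅b 2, b 3⁆ = σ • b 2

namespace IsModelBasis

variable {b : Basis (Fin 4) ℝ Q} {σ : ℝ}

theorem trace_ad (h : IsModelBasis b σ) :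
    LinearMap.trace ℝ Q (LieAlgebra.ad ℝ Q (b 3)) = -4 * σ := by
  have h32 : ⁅b 3, b 2⁆ = -σ • b 2 := by rw [← lie_skew, h.lie_two_three, neg_smul]
  rw [LinearMap.trace_eq_matrix_trace ℝ b]
  simp [Matrix.trace, Fin.sum_univ_four, LinearMap.toMatrix_apply, h.lie_three_zero,
    h.lie_three_one, h32]
  ring

theorem coord_one_lie (h : IsModelBasis b σ) (p q r s : ℝ) :
    b.coord 1 ⁅p • b 0 + q • b 1 + r • b 2 + s • b 3, p • b 2 + q • b 3 - r • b 0 - s • b 1⁆ =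
      -(p ^ 2 + r ^ 2) + 2 * σ * (q ^ 2 + s ^ 2) := by
  have h10 : ⁅b 1, b 0⁆ = 0 := by rw [← lie_skew, h.lie_zero_one, neg_zero]
  have h02 : ⁅b 0, b 2⁆ = -b 1 := by rw [← lie_skew, h.lie_two_zero]
  have h12 : ⁅b 1, b 2⁆ = 0 := by rw [← lie_skew, h.lie_two_one, neg_zero]
  have h03 : ⁅b 0, b 3⁆ = σ • b 0 := by rw [← lie_skew, h.lie_three_zero]; module
  have h13 : ⁅b 1, b 3⁆ = (2 * σ) • b 1 := by rw [← lie_skew, h.lie_three_one]; module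
  have h32 : ⁅b 3, b 2⁆ = -σ • b 2 := by rw [← lie_skew, h.lie_two_three, neg_smul]
  simp [h.lie_zero_one, h.lie_two_zero, h.lie_two_one, h.lie_three_zero, h.lie_three_one,
    h.lie_two_three, h10, h02, h12, h03, h13, h32]
  ring

end IsModelBasis

end Model

section Setup

variable {L : Type*} [LieRing L] [LieAlgebra ℝ L] {a I : LieIdeal ℝ L} {J : L →ₗ[ℝ] L}

/-- The dimension of `a ⊓ J a` for a codimension-two subspace `a` that is not `J`-invariant. -/
theorem finrank_inf_map_of_codim_two [FiniteDimensional ℝ L] (S : Submodule ℝ L)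
    (hJ : ∀ x, J (J x) = -x) (hcodim : finrank ℝ S + 2 = finrank ℝ L) (hS : S.map J ≠ S) :
    finrank ℝ (S ⊓ S.map J : Submodule ℝ L) + 2 = finrank ℝ S ∧ S ⊔ S.map J = ⊤ := by
  have hinj : Function.Injective J := fun u v h => by
    have := congrArg J h
    rwa [hJ, hJ, neg_inj] at this
  have hmap : finrank ℝ (S.map J) = finrank ℝ S :=
    (Submodule.equivMapOfInjective J hinj S).finrank_eq.symm
  have hP : ∀ v ∈ S ⊔ S.map J, J v ∈ S ⊔ S.map J := by
    intro v hv
    obtain ⟨s, hs, w, hw, rfl⟩ := Submodule.mem_sup.mp hv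
    obtain ⟨t, ht, rfl⟩ := hw
    rw [map_add, hJ]
    exact add_mem (Submodule.mem_sup_right ⟨s, hs, rfl⟩)
      (Submodule.mem_sup_left (neg_mem ht))
  have hevL := even_finrank_of_sq_eq_neg J hJ
  have hevP : Even (finrank ℝ (S ⊔ S.map J : Submodule ℝ L)) :=
    even_finrank_of_sq_eq_neg (J.restrict hP) fun x => Subtype.ext (hJ x)
  have hlt : finrank ℝ S < finrank ℝ (S ⊔ S.map J : Submodule ℝ L) := by
    apply Submodule.finrank_lt_finrank_of_lt
    refine lt_of_le_of_ne le_sup_left fun h => hS ?_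
    exact Submodule.eq_of_le_of_finrank_eq (le_sup_right.trans h.ge) hmap
  have hle := Submodule.finrank_le (S ⊔ S.map J)
  have hsum := Submodule.finrank_sup_add_finrank_inf_eq S (S.map J)
  rw [hmap] at hsum
  obtain ⟨k, hk⟩ := hevL
  obtain ⟨m, hm⟩ := hevP
  have htop : finrank ℝ (S ⊔ S.map J : Submodule ℝ L) = finrank ℝ L := by omega
  exact ⟨by omega, Submodule.eq_top_of_finrank_eq htop⟩

/-- `ad (J z)` commutes with `J` on the maximal complex subspace of an abelian ideal. -/
theorem lie_J_comm (habel : ∀ u ∈ a, ∀ v ∈ a, ⁅u, v⁆ = (0 : L)) (hJ : IsComplexStructure J)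
    {z u : L} (hz : z ∈ a) (hu : u ∈ a) (hJu : J u ∈ a) : ⁅J z, J u⁆ = J ⁅J z, u⁆ := by
  have h := hJ.2 z u
  rw [habel z hz u hu, habel z hz _ hJu, map_zero] at h
  linear_combination (norm := module) -h

/-- The maximal complex subspace of an abelian ideal `a` with `a + J a = L` is an ideal. -/
theorem exists_lieIdeal_inf_map (habel : ∀ u ∈ a, ∀ v ∈ a, ⁅u, v⁆ = (0 : L))
    (hJ : IsComplexStructure J) (htop : a.toSubmodule ⊔ a.toSubmodule.map J = ⊤) :
    ∃ I : LieIdeal ℝ L, I.toSubmodule = a.toSubmodule ⊓ a.toSubmodule.map J ∧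
      ∀ u, u ∈ I ↔ u ∈ a ∧ J u ∈ a := by
  have hmem : ∀ u, u ∈ a.toSubmodule ⊓ a.toSubmodule.map J ↔ u ∈ a ∧ J u ∈ a := by
    refine fun u => ⟨?_, fun h => ⟨h.1, -J u, neg_mem h.2, by rw [map_neg, hJ.1, neg_neg]⟩⟩
    rintro ⟨hu, w, hw, rfl⟩
    exact ⟨hu, by rw [hJ.1]; exact neg_mem hw⟩
  refine ⟨{ a.toSubmodule ⊓ a.toSubmodule.map J with lie_mem := ?_ }, rfl, hmem⟩
  intro v u hu
  obtain ⟨hua, hJu⟩ := (hmem u).mp hu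
  refine (hmem _).mpr ?_
  obtain ⟨s, hs, w, ⟨t, ht, rfl⟩, rfl⟩ :=
    Submodule.mem_sup.mp (htop ▸ Submodule.mem_top : v ∈ a.toSubmodule ⊔ a.toSubmodule.map J)
  rw [add_lie, habel s hs u hua, zero_add]
  refine ⟨lie_mem_right ℝ L a _ _ hua, ?_⟩
  rw [← lie_J_comm habel hJ ht hua hJu]
  exact lie_mem_right ℝ L a _ _ hJu

/-- The pluriclosed condition evaluated on `u, Ju, Jz, z`. -/
theorem HermMetric.pluriclosed_identity (g : HermMetric J) (hg : g.IsPluriclosed)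
    (habel : ∀ u ∈ a, ∀ v ∈ a, ⁅u, v⁆ = (0 : L)) (hJ : IsComplexStructure J)
    {z u : L} (hz : z ∈ a) (hu : u ∈ a) (hJu : J u ∈ a) :
    g.B ⁅J z, u⁆ ⁅J z, u⁆ + g.B ⁅J z, ⁅J z, u⁆⁆ u + g.B ⁅J ⁅J z, z⁆, u⁆ u = 0 := by
  have key := hg u (J u) (J z) z
  have hJJ := hJ.1
  have hv : ⁅J z, u⁆ ∈ a := lie_mem_right ℝ L a _ _ hu
  have hJv : J ⁅J z, u⁆ ∈ a := by
    rw [← lie_J_comm habel hJ hz hu hJu]; exact lie_mem_right ℝ L a _ _ hJu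
  have hw : ⁅J z, z⁆ ∈ a := lie_mem_right ℝ L a _ _ hz
  have e1 := lie_J_comm habel hJ hz hu hJu
  have e2 := lie_J_comm habel hJ hz hv hJv
  have e3 := lie_J_comm habel hJ hw hu hJu
  have f1 : ⁅u, J z⁆ = -⁅J z, u⁆ := (lie_skew _ _).symm
  have f2 : ⁅J u, J z⁆ = -J ⁅J z, u⁆ := by rw [← lie_skew, e1]
  generalize hvd : ⁅J z, u⁆ = v at *
  generalize hwd : ⁅J z, z⁆ = w at *
  generalize hv2 : ⁅J z, v⁆ = v2 at *
  generalize hv3 : ⁅J w, u⁆ = v3 at *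
  have f3 : ⁅v, J z⁆ = -v2 := by rw [← lie_skew, hv2]
  have f4 : ⁅J v, J z⁆ = -J v2 := by rw [← lie_skew, e2]
  simp only [HermMetric.ddcOmega, HermMetric.dcOmega, HermMetric.dOmega, HermMetric.omega,
    habel u hu _ hJu, habel u hu z hz, habel _ hJu z hz, habel _ hJv u hu, habel v hv _ hJu,
    habel _ hJu u hu, hJJ, f1, f2, f3, f4, hwd, hv3, e3, map_neg, map_zero, neg_neg, neg_lie,
    lie_neg, zero_lie, LinearMap.neg_apply, LinearMap.zero_apply, g.compat] at key
  linarith [g.symm v v2]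

/-- The quotient map by a Lie ideal, as a linear map. -/
def lieQuotientMap (I : LieIdeal ℝ L) : L →ₗ[ℝ] L ⧸ I := I.toSubmodule.mkQ

theorem lieQuotientMap_lie (u v : L) :
    lieQuotientMap I ⁅u, v⁆ = ⁅lieQuotientMap I u, lieQuotientMap I v⁆ := rfl

theorem lieQuotientMap_eq_zero {u : L} : lieQuotientMap I u = 0 ↔ u ∈ I :=
  Submodule.Quotient.mk_eq_zero I.toSubmodule

theorem exists_basis_quotient [FiniteDimensional ℝ L]
    (hI : ∀ u, u ∈ I ↔ u ∈ a ∧ J u ∈ a) (hIL : finrank ℝ I.toSubmodule + 4 = finrank ℝ L)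
    {x y : L} (hx : x ∈ a) (hy : y ∈ a)
    (hli : ∀ s t : ℝ, s • x + t • y ∈ I → s = 0 ∧ t = 0) :
    ∃ b : Basis (Fin 4) ℝ (L ⧸ I), b 0 = lieQuotientMap I x ∧ b 1 = lieQuotientMap I y ∧
      b 2 = lieQuotientMap I (J x) ∧ b 3 = lieQuotientMap I (J y) := by
  let v : Fin 4 → L ⧸ I.toSubmodule := lieQuotientMap I ∘ ![x, y, J x, J y]
  have hv : LinearIndependent ℝ v := by
    rw [Fintype.linearIndependent_iff]
    intro c hc
    have hc' : lieQuotientMap I (c 0 • x + c 1 • y + c 2 • J x + c 3 • J y) = 0 := by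
      simpa [Fin.sum_univ_four, v] using hc
    rw [lieQuotientMap_eq_zero] at hc'
    have hxy : ∀ s t : ℝ, s • x + t • y ∈ a := fun s t =>
      add_mem (a.smul_mem s hx) (a.smul_mem t hy)
    have h23 : c 2 • x + c 3 • y ∈ I := by
      refine (hI _).mpr ⟨hxy _ _, ?_⟩
      have h := sub_mem ((hI _).mp hc').1 (hxy (c 0) (c 1))
      convert h using 1
      simp only [map_add, map_smul]
      module
    obtain ⟨h2, h3⟩ := hli _ _ h23
    rw [h2, h3, zero_smul, zero_smul, add_zero, add_zero] at hc'
    obtain ⟨h0, h1⟩ := hli _ _ hc'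
    intro i
    fin_cases i <;> assumption
  have hcard : Fintype.card (Fin 4) = finrank ℝ (L ⧸ I.toSubmodule) := by
    have := Submodule.finrank_quotient_add_finrank I.toSubmodule
    rw [Fintype.card_fin]
    omega
  refine ⟨basisOfLinearIndependentOfCardEqFinrank hv hcard, ?_, ?_, ?_, ?_⟩ <;>
    exact congrFun (coe_basisOfLinearIndependentOfCardEqFinrank hv hcard) _

/-- A vector `x` of the abelian ideal `a` which, together with `⁅Jx, x⁆`, spans `a` modulo its
maximal complex subspace `I`, and such that `⁅Jx, J⁅Jx, x⁆⁆` is `σ • Jx` modulo `I`. -/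
structure IsAdapted (a I : LieIdeal ℝ L) (J : L →ₗ[ℝ] L) (x : L) (σ : ℝ) : Prop where
  abelian : ∀ u ∈ a, ∀ v ∈ a, ⁅u, v⁆ = (0 : L)
  isComplex : IsComplexStructure J
  mem_iff : ∀ u, u ∈ I ↔ u ∈ a ∧ J u ∈ a
  finrank_add : finrank ℝ I.toSubmodule + 4 = finrank ℝ L
  not_lie_mem : ¬ ∀ u v : L, ⁅u, v⁆ ∈ a
  mem : x ∈ a
  independent : ∀ s t : ℝ, s • x + t • ⁅J x, x⁆ ∈ I → s = 0 ∧ t = 0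
  lie_sub_mem : ⁅J x, J ⁅J x, x⁆⁆ - σ • J x ∈ I

namespace IsAdapted

variable {x : L} {σ : ℝ}

theorem lie_mem (h : IsAdapted a I J x σ) : ⁅J x, x⁆ ∈ a := lie_mem_right ℝ L a _ _ h.mem

theorem exists_basis [FiniteDimensional ℝ L] (h : IsAdapted a I J x σ) :
    ∃ b : Basis (Fin 4) ℝ (L ⧸ I), b 0 = lieQuotientMap I x ∧
      b 1 = lieQuotientMap I ⁅J x, x⁆ ∧ b 2 = lieQuotientMap I (J x) ∧
      b 3 = lieQuotientMap I (J ⁅J x, x⁆) :=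
  exists_basis_quotient h.mem_iff h.finrank_add h.mem h.lie_mem h.independent

theorem exists_decomposition [FiniteDimensional ℝ L] (h : IsAdapted a I J x σ) (u : L) :
    ∃ i ∈ I, ∃ p q r s : ℝ,
      u = i + (p • x + q • ⁅J x, x⁆ + r • J x + s • J ⁅J x, x⁆) := by
  obtain ⟨b, h0, h1, h2, h3⟩ := h.exists_basis
  have hu := b.sum_repr (lieQuotientMap I u)
  rw [Fin.sum_univ_four, h0, h1, h2, h3] at hu
  generalize b.repr (lieQuotientMap I u) = c at hu
  refine ⟨u - (c 0 • x + c 1 • ⁅J x, x⁆ + c 2 • J x + c 3 • J ⁅J x, x⁆), ?_,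
    c 0, c 1, c 2, c 3, (sub_add_cancel u _).symm⟩
  rw [← lieQuotientMap_eq_zero, map_sub, sub_eq_zero]
  simpa only [map_add, map_smul] using hu.symm

theorem ne_zero [FiniteDimensional ℝ L] (h : IsAdapted a I J x σ) : σ ≠ 0 := by
  rintro rfl
  have hxy : ⁅J x, J ⁅J x, x⁆⁆ ∈ a := by
    have := h.lie_sub_mem
    rw [zero_smul, sub_zero] at this
    exact ((h.mem_iff _).mp this).1
  have hdec : ∀ u : L, ∃ w ∈ a, ∃ r s : ℝ, u = w + (r • J x + s • J ⁅J x, x⁆) := by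
    intro u
    obtain ⟨i, hi, p, q, r, s, rfl⟩ := h.exists_decomposition u
    exact ⟨i + (p • x + q • ⁅J x, x⁆), add_mem ((h.mem_iff _).mp hi).1
        (add_mem (a.smul_mem _ h.mem) (a.smul_mem _ h.lie_mem)), r, s, by abel⟩
  refine h.not_lie_mem fun u v => ?_
  obtain ⟨w, hw, r, s, rfl⟩ := hdec u
  obtain ⟨w', hw', r', s', rfl⟩ := hdec v
  generalize J ⁅J x, x⁆ = y' at *
  rw [add_lie, lie_add (r • J x + s • y')]
  refine add_mem (lie_mem_left ℝ L a _ _ hw) (add_mem (lie_mem_right ℝ L a _ _ hw') ?_)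
  have : ⁅r • J x + s • y', r' • J x + s' • y'⁆ = (r * s' - s * r') • ⁅J x, y'⁆ := by
    simp only [add_lie, lie_add, smul_lie, lie_smul, lie_self, ← lie_skew y' (J x)]
    module
  rw [this]
  exact a.smul_mem _ hxy

/-- Elements of `a` are combinations of `x` and `⁅Jx, x⁆` modulo `I`. -/
theorem exists_of_mem [FiniteDimensional ℝ L] (h : IsAdapted a I J x σ) {v : L} (hv : v ∈ a) :
    ∃ p q : ℝ,
      lieQuotientMap I v = p • lieQuotientMap I x + q • lieQuotientMap I ⁅J x, x⁆ := by
  obtain ⟨i, hi, p, q, r, s, rfl⟩ := h.exists_decomposition v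
  have hxy : ∀ s t : ℝ, s • x + t • ⁅J x, x⁆ ∈ a := fun s t =>
    add_mem (a.smul_mem s h.mem) (a.smul_mem t h.lie_mem)
  have hrs : r • x + s • ⁅J x, x⁆ ∈ I := by
    refine (h.mem_iff _).mpr ⟨hxy _ _, ?_⟩
    have h' := sub_mem (sub_mem hv ((h.mem_iff _).mp hi).1) (hxy p q)
    convert h' using 1
    simp only [map_add, map_smul]
    module
  obtain ⟨rfl, rfl⟩ := h.independent _ _ hrs
  refine ⟨p, q, ?_⟩
  simp [lieQuotientMap_eq_zero.mpr hi]

theorem exists_isModelBasis [FiniteDimensional ℝ L] (h : IsAdapted a I J x σ) :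
    ∃ b : Basis (Fin 4) ℝ (L ⧸ I), IsModelBasis b σ ∧ b 0 = lieQuotientMap I x ∧
      b 1 = lieQuotientMap I ⁅J x, x⁆ ∧ b 2 = lieQuotientMap I (J x) ∧
      b 3 = lieQuotientMap I (J ⁅J x, x⁆) := by
  obtain ⟨b, h0, h1, h2, h3⟩ := h.exists_basis
  refine ⟨b, ?_, h0, h1, h2, h3⟩
  have hx := h.mem
  have hy := h.lie_mem
  have hσ := h.ne_zero
  have hlie : lieQuotientMap I ⁅J x, J ⁅J x, x⁆⁆ = σ • lieQuotientMap I (J x) := by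
    rw [← sub_eq_zero, ← map_smul, ← map_sub]
    exact lieQuotientMap_eq_zero.mpr h.lie_sub_mem
  obtain ⟨c, e, hce⟩ := h.exists_of_mem (lie_mem_right ℝ L a (J x) _ hy)
  obtain ⟨d, f, hdf⟩ := h.exists_of_mem (lie_mem_right ℝ L a (J ⁅J x, x⁆) _ hy)
  have hD : lieQuotientMap I ⁅J ⁅J x, x⁆, x⁆ =
      lieQuotientMap I ⁅J x, ⁅J x, x⁆⁆ - σ • lieQuotientMap I x := by
    rw [← map_smul, ← map_sub, ← sub_eq_zero, ← map_sub, lieQuotientMap_eq_zero]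
    have hJ := h.isComplex.2 x ⁅J x, x⁆
    rw [h.abelian x hx _ hy, ← lie_skew x] at hJ
    have hm := ((h.mem_iff _).mp h.lie_sub_mem)
    refine (h.mem_iff _).mpr ⟨sub_mem (lie_mem_right ℝ L a _ _ hx)
      (sub_mem (lie_mem_right ℝ L a _ _ hy) (a.smul_mem _ hx)), ?_⟩
    convert neg_mem hm.1 using 1
    simp only [map_sub, map_smul, map_neg] at hJ ⊢
    linear_combination (norm := module) -hJ
  have hXY : (⁅lieQuotientMap I x, lieQuotientMap I ⁅J x, x⁆⁆ : L ⧸ I) = 0 := by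
    rw [← lieQuotientMap_lie, h.abelian x hx _ hy, map_zero]
  have hX : (⁅lieQuotientMap I (J x), lieQuotientMap I x⁆ : L ⧸ I) =
    lieQuotientMap I ⁅J x, x⁆ := rfl
  have hli : ∀ s t : ℝ, s • lieQuotientMap I x + t • lieQuotientMap I ⁅J x, x⁆ = 0 →
      s = 0 ∧ t = 0 := by
    intro s t hst
    rw [← map_smul, ← map_smul, ← map_add, lieQuotientMap_eq_zero] at hst
    exact h.independent s t hst
  obtain ⟨k1, k2, k3⟩ := model_brackets (X' := lieQuotientMap I (J x))
    (Y' := lieQuotientMap I (J ⁅J x, x⁆)) hσ hX hlie hD hce hdf hli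
  constructor <;> simp only [h0, h1, h2, h3] <;> assumption

/-- The restriction of `ad z` to a Lie ideal. -/
def adRestrict (I : LieIdeal ℝ L) (z : L) : I.toSubmodule →ₗ[ℝ] I.toSubmodule :=
  (LieAlgebra.ad ℝ L z).restrict fun u hu => lie_mem_right ℝ L I z u hu

theorem trace_adRestrict [FiniteDimensional ℝ L] (h : IsAdapted a I J x σ)
    (huni : IsUnimodularLie L) :
    LinearMap.trace ℝ I.toSubmodule (adRestrict I (J ⁅J x, x⁆)) = 4 * σ := by
  obtain ⟨b, hb, -, -, -, h3⟩ := h.exists_isModelBasis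
  have htr := hb.trace_ad
  rw [h3] at htr
  have hsum := trace_eq_trace_restrict_add_trace_mapQ I.toSubmodule
    (LieAlgebra.ad ℝ L (J ⁅J x, x⁆)) fun u hu => lie_mem_right ℝ L I _ u hu
  have hmap : I.toSubmodule.mapQ I.toSubmodule (LieAlgebra.ad ℝ L (J ⁅J x, x⁆))
      (fun u hu => lie_mem_right ℝ L I _ u hu) =
      LieAlgebra.ad ℝ (L ⧸ I) (lieQuotientMap I (J ⁅J x, x⁆)) := by
    ext u
    rfl
  rw [huni, hmap] at hsum
  change 0 = LinearMap.trace ℝ I.toSubmodule (adRestrict I (J ⁅J x, x⁆)) +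
    LinearMap.trace ℝ (L ⧸ I) _ at hsum
  linarith

theorem trace_adRestrict_sq [FiniteDimensional ℝ L] (h : IsAdapted a I J x σ) :
    LinearMap.trace ℝ I.toSubmodule (adRestrict I (J x) * adRestrict I (J x)) = 0 := by
  set A := adRestrict I (J x) with hA
  set D := adRestrict I (J ⁅J x, x⁆) with hD
  have hcomm : A * D - D * A = σ • A := by
    ext u
    have hu : ⁅⁅J x, J ⁅J x, x⁆⁆ - σ • J x, (u : L)⁆ = 0 :=
      h.abelian _ ((h.mem_iff _).mp h.lie_sub_mem).1 _ ((h.mem_iff _).mp u.2).1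
    rw [sub_lie, sub_eq_zero, smul_lie, lie_lie] at hu
    exact hu
  have hmul : σ • (A * A) = A * D * A - D * A * A := by
    rw [← sub_mul, hcomm, smul_mul_assoc]
  have htr := congrArg (LinearMap.trace ℝ I.toSubmodule) hmul
  rw [map_smul, map_sub, mul_assoc, LinearMap.trace_mul_comm ℝ A (D * A), sub_self,
    smul_eq_mul] at htr
  exact (mul_eq_zero.mp htr).resolve_left h.ne_zero

theorem neg_of_isPluriclosed [FiniteDimensional ℝ L] (h : IsAdapted a I J x σ)
    (huni : IsUnimodularLie L) (g : HermMetric J) (hg : g.IsPluriclosed) : σ < 0 := by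
  let B := (g.B.domRestrict₁₂ I.toSubmodule I.toSubmodule)
  obtain ⟨b, hb⟩ := exists_basis_of_posDef B (fun u v => g.symm u v)
    (fun u hu => g.posdef u (by simpa using hu)) rfl
  have hD := trace_eq_sum_of_orthonormal B b hb (adRestrict I (J ⁅J x, x⁆))
  have hA := trace_eq_sum_of_orthonormal B b hb (adRestrict I (J x) * adRestrict I (J x))
  rw [h.trace_adRestrict huni] at hD
  rw [h.trace_adRestrict_sq] at hA
  have hnonneg : ∀ v : L, 0 ≤ g.B v v := fun v => by
    rcases eq_or_ne v 0 with rfl | hv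
    · simp
    · exact (g.posdef v hv).le
  have hsum : 4 * σ = ∑ i, (B (adRestrict I (J ⁅J x, x⁆) (b i)) (b i) +
      B ((adRestrict I (J x) * adRestrict I (J x)) (b i)) (b i)) := by
    rw [Finset.sum_add_distrib, ← hD, ← hA, add_zero]
  have hle : 4 * σ ≤ 0 := by
    rw [hsum]
    refine Finset.sum_nonpos fun i _ => ?_
    obtain ⟨hu, hJu⟩ := (h.mem_iff _).mp (b i).2
    have key := g.pluriclosed_identity hg h.abelian h.isComplex h.mem hu hJu
    change g.B ⁅J ⁅J x, x⁆, (b i : L)⁆ (b i : L) + g.B ⁅J x, ⁅J x, (b i : L)⁆⁆ (b i : L) ≤ 0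
    linarith [hnonneg ⁅J x, (b i : L)⁆]
  exact lt_of_le_of_ne (by linarith) h.ne_zero

end IsAdapted

/-- On a unimodular Lie algebra, a balanced metric satisfies `∑ ⁅f k, J (f k)⁆ = 0` for every
orthonormal basis `f`. -/
theorem HermMetric.IsBalanced.sum_lie_eq_zero [FiniteDimensional ℝ L] {g : HermMetric J} {n : ℕ}
    (hg : g.IsBalanced n) (hJ : ∀ x, J (J x) = -x) (huni : IsUnimodularLie L)
    (f : Basis (Fin (2 * n)) ℝ L) (hf : ∀ i j, g.B (f i) (f j) = if i = j then 1 else 0) :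
    ∑ k, ⁅f k, J (f k)⁆ = 0 := by
  have hBJ : ∀ u v, g.B u (J v) = -g.B (J u) v := fun u v => by
    rw [← g.compat u (J v), hJ, map_neg]
  have hzero : ∀ v, g.B (J (∑ k, ⁅f k, J (f k)⁆)) v = 0 := by
    intro v
    have h1 := trace_eq_sum_of_orthonormal g.B f hf (LieAlgebra.ad ℝ L v)
    have h2 := trace_eq_sum_of_orthonormal g.B f hf (J * (LieAlgebra.ad ℝ L v * J))
    rw [LinearMap.trace_mul_comm, mul_assoc,
      show J * J = -1 from LinearMap.ext fun u => hJ u, mul_neg_one, map_neg, huni] at h2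
    rw [huni] at h1
    have hsum := hg f hf v
    have hterm : ∀ k, g.dOmega (f k) (J (f k)) v = -g.B (J ⁅f k, J (f k)⁆) v +
        g.B (LieAlgebra.ad ℝ L v (f k)) (f k) * (-1) +
        g.B ((J * (LieAlgebra.ad ℝ L v * J)) (f k)) (f k) := by
      intro k
      simp only [HermMetric.dOmega, HermMetric.omega, Module.End.mul_apply, LieAlgebra.ad_apply,
        g.compat]
      rw [← lie_skew v (f k), ← lie_skew v (J (f k))]
      simp only [map_neg, LinearMap.neg_apply]
      ring
    simp only [hterm, Finset.sum_add_distrib, ← Finset.sum_mul, ← h1, ← h2] at hsum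
    simpa using hsum
  have hJz : J (∑ k, ⁅f k, J (f k)⁆) = 0 := by
    by_contra hne
    exact (g.posdef _ hne).ne' (hzero _)
  rw [← neg_eq_zero, ← hJ, hJz, map_zero]

theorem IsAdapted.not_isBalanced [FiniteDimensional ℝ L] {x : L} {σ : ℝ}
    (h : IsAdapted a I J x σ) (huni : IsUnimodularLie L) (hσ : σ < 0) {n : ℕ}
    (hdim : finrank ℝ L = 2 * n) (g : HermMetric J) : ¬ g.IsBalanced n := by
  intro hg
  obtain ⟨f, hf⟩ := exists_basis_of_posDef g.B g.symm g.posdef hdim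
  have hsum := hg.sum_lie_eq_zero h.isComplex.1 huni f hf
  obtain ⟨b, hb, h0, h1, h2, h3⟩ := h.exists_isModelBasis
  have hcoord : ∀ u : L, ∃ i ∈ I, ∃ p q r s : ℝ,
      u = i + (p • x + q • ⁅J x, x⁆ + r • J x + s • J ⁅J x, x⁆) ∧
      b.coord 1 (lieQuotientMap I ⁅u, J u⁆) = -(p ^ 2 + r ^ 2) + 2 * σ * (q ^ 2 + s ^ 2) := by
    intro u
    obtain ⟨i, hi, p, q, r, s, hu⟩ := h.exists_decomposition u
    refine ⟨i, hi, p, q, r, s, hu, ?_⟩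
    have hJi : J i ∈ I := (h.mem_iff _).mpr
      ⟨((h.mem_iff _).mp hi).2, by rw [h.isComplex.1]; exact neg_mem ((h.mem_iff _).mp hi).1⟩
    rw [← hb.coord_one_lie p q r s, lieQuotientMap_lie, h0, h1, h2, h3, hu]
    simp only [map_add, map_smul, lieQuotientMap_eq_zero.mpr hi, lieQuotientMap_eq_zero.mpr hJi,
      zero_add, h.isComplex.1, map_neg, smul_neg]
    congr 2
    abel
  have hnonpos : ∀ u : L, b.coord 1 (lieQuotientMap I ⁅u, J u⁆) ≤ 0 := by
    intro u
    obtain ⟨i, hi, p, q, r, s, -, hu⟩ := hcoord u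
    rw [hu]
    nlinarith [sq_nonneg p, sq_nonneg q, sq_nonneg r, sq_nonneg s]
  have hall : ∀ k, b.coord 1 (lieQuotientMap I ⁅f k, J (f k)⁆) = 0 := by
    have hs := congrArg (fun v => b.coord 1 (lieQuotientMap I v)) hsum
    simp only [map_sum, map_zero] at hs
    exact fun k => (Finset.sum_eq_zero_iff_of_nonpos fun k _ => hnonpos (f k)).mp hs k
      (Finset.mem_univ k)
  have hmem : ∀ k, f k ∈ I.toSubmodule := by
    intro k
    obtain ⟨i, hi, p, q, r, s, hu, hc⟩ := hcoord (f k)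
    rw [hall k] at hc
    have hqs : 0 ≤ -σ * (q ^ 2 + s ^ 2) := by
      have := neg_pos.mpr hσ
      positivity
    have hpr : p ^ 2 + r ^ 2 = 0 := by nlinarith [sq_nonneg p, sq_nonneg r]
    have hqs' : q ^ 2 + s ^ 2 = 0 := by
      have : σ * (q ^ 2 + s ^ 2) = 0 := by nlinarith
      exact (mul_eq_zero.mp this).resolve_left hσ.ne
    have hp : p = 0 := by nlinarith [sq_nonneg p, sq_nonneg r]
    have hr : r = 0 := by nlinarith [sq_nonneg p, sq_nonneg r]
    have hq : q = 0 := by nlinarith [sq_nonneg q, sq_nonneg s]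
    have hs : s = 0 := by nlinarith [sq_nonneg q, sq_nonneg s]
    rw [hu, hp, hq, hr, hs]
    simpa using hi
  have htop : I.toSubmodule = ⊤ := by
    rw [eq_top_iff, ← f.span_eq, Submodule.span_le]
    rintro _ ⟨k, rfl⟩
    exact hmem k
  have := h.finrank_add
  rw [htop, finrank_top] at this
  omega

/-- If `J b` does not normalise `b`, where `I ≤ b ≤ a` and `I` has codimension two in `a`, then
`b = I ⊕ ℝ x` for every `x ∈ b` outside `I`. -/
theorem eq_sup_span_of_generic [FiniteDimensional ℝ L] {b : Submodule ℝ L}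
    (hIa : finrank ℝ I.toSubmodule + 2 = finrank ℝ a.toSubmodule)
    (hIb : I.toSubmodule ≤ b) (hba : b ≤ a.toSubmodule)
    (hgen : ¬ ∀ u ∈ b, ∀ v ∈ b, ⁅J u, v⁆ ∈ b) {x : L} (hx : x ∈ b) (hxI : x ∉ I) :
    I.toSubmodule ⊔ Submodule.span ℝ {x} = b := by
  have hle : I.toSubmodule ⊔ Submodule.span ℝ {x} ≤ b :=
    sup_le hIb ((Submodule.span_singleton_le_iff_mem _ _).mpr hx)
  have hne : b ≠ a.toSubmodule := by
    rintro rfl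
    exact hgen fun u _ v hv => lie_mem_right ℝ L a _ _ hv
  have h1 := Submodule.finrank_lt_finrank_of_lt (lt_of_le_of_ne hba hne)
  have h2 : finrank ℝ I.toSubmodule <
      finrank ℝ (I.toSubmodule ⊔ Submodule.span ℝ {x} : Submodule ℝ L) := by
    refine Submodule.finrank_lt_finrank_of_lt (lt_of_le_of_ne le_sup_left fun h => hxI ?_)
    have : x ∈ I.toSubmodule ⊔ Submodule.span ℝ {x} :=
      Submodule.mem_sup_right (Submodule.mem_span_singleton_self x)
    rwa [← h] at this
  exact Submodule.eq_of_le_of_finrank_le hle (by omega)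

theorem lie_not_mem_of_generic [FiniteDimensional ℝ L] {b : Submodule ℝ L}
    (habel : ∀ u ∈ a, ∀ v ∈ a, ⁅u, v⁆ = (0 : L)) (hI : ∀ u, u ∈ I ↔ u ∈ a ∧ J u ∈ a)
    (hIb : I.toSubmodule ≤ b) (hba : b ≤ a.toSubmodule)
    (hgen : ¬ ∀ u ∈ b, ∀ v ∈ b, ⁅J u, v⁆ ∈ b) {x : L}
    (hb : I.toSubmodule ⊔ Submodule.span ℝ {x} = b) : ⁅J x, x⁆ ∉ b := by
  intro hxx
  refine hgen fun u hu v hv => ?_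
  have hv' := hv
  rw [← hb] at hu hv
  obtain ⟨u', hu', w, hw, rfl⟩ := Submodule.mem_sup.mp hu
  obtain ⟨s, rfl⟩ := Submodule.mem_span_singleton.mp hw
  obtain ⟨v', hv'I, w', hw', rfl⟩ := Submodule.mem_sup.mp hv
  obtain ⟨t, rfl⟩ := Submodule.mem_span_singleton.mp hw'
  rw [map_add, add_lie, habel _ ((hI u').mp hu').2 _ (hba hv'), zero_add, map_smul, smul_lie,
    lie_add, lie_smul]
  exact b.smul_mem _ (add_mem (hIb (lie_mem_right ℝ L I _ _ hv'I)) (b.smul_mem _ hxx))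

end Setup

theorem stmt11
    {L : Type*} [LieRing L] [LieAlgebra ℝ L] [FiniteDimensional ℝ L]
    (a : LieIdeal ℝ L)
    (habel : ∀ u ∈ a.toSubmodule, ∀ v ∈ a.toSubmodule, ⁅u, v⁆ = (0 : L))
    (hcodim : finrank ℝ ↥a.toSubmodule + 2 = finrank ℝ L)
    (J : L →ₗ[ℝ] L) (hJ : IsComplexStructure J)
    (huni : IsUnimodularLie L)
    (n : ℕ) (hdim : finrank ℝ L = 2 * n)
    (hJa : a.toSubmodule.map J ≠ a.toSubmodule)
    (hnonab : ¬ ∀ u v : L, ⁅u, v⁆ ∈ a.toSubmodule)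
    (aJ a' bb : Submodule ℝ L)
    (haJ : aJ = a.toSubmodule ⊓ a.toSubmodule.map J)
    (ha' : a' = a.toSubmodule ⊔ Submodule.span ℝ {z : L | ∃ u v : L, ⁅u, v⁆ = z})
    (hbb : bb = a.toSubmodule ⊓ a'.map J)
    (hgen : ¬ ∀ u ∈ bb, ∀ v ∈ bb, ⁅J u, v⁆ ∈ bb)
    (hplu : ∃ g : HermMetric J, g.IsPluriclosed) :
    (∀ x y : L, x ∈ bb → x ∉ aJ → y ∈ a.toSubmodule →
      a.toSubmodule = aJ ⊔ Submodule.span ℝ {x} ⊔ Submodule.span ℝ {y} →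
      (∀ (s t : ℝ) (u : L), u ∈ aJ → s • x + t • y + u = 0 → s = 0 ∧ t = 0) →
      ∀ σ a₀ b₀ : ℝ,
        ⁅J x, J y⁆ - σ • J x ∈ aJ →
        ⁅J x, x⁆ - (a₀ • x + b₀ • y) ∈ aJ →
        σ * b₀ < 0) ∧
    ¬ ∃ g : HermMetric J, g.IsBalanced n := by
  obtain ⟨hIa, htop⟩ := finrank_inf_map_of_codim_two a.toSubmodule hJ.1 hcodim hJa
  obtain ⟨I, hIeq, hI⟩ := exists_lieIdeal_inf_map habel hJ htop
  rw [← hIeq] at hIa haJ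
  subst haJ
  have hba : bb ≤ a.toSubmodule := hbb ▸ inf_le_left
  have hIb : I.toSubmodule ≤ bb := by
    intro u hu
    obtain ⟨hua, hJu⟩ := (hI u).mp hu
    rw [hbb, ha']
    exact ⟨hua, -J u, Submodule.mem_sup_left (neg_mem hJu), by rw [map_neg, hJ.1, neg_neg]⟩
  have hadapted : ∀ x ∈ bb, x ∉ I → ∀ σ : ℝ, ⁅J x, J ⁅J x, x⁆⁆ - σ • J x ∈ I →
      IsAdapted a I J x σ := by
    intro x hx hxI σ hσ
    have hspan := eq_sup_span_of_generic hIa hIb hba hgen hx hxI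
    have hxx := lie_not_mem_of_generic habel hI hIb hba hgen hspan
    refine ⟨habel, hJ, hI, by omega, hnonab, hba hx, fun s t hst => ?_, hσ⟩
    have ht : t = 0 := by
      by_contra ht
      refine hxx ((bb.smul_mem_iff ht).mp ?_)
      have := sub_mem (hIb hst) (bb.smul_mem s hx)
      rwa [add_sub_cancel_left] at this
    rw [ht, zero_smul, add_zero] at hst
    exact ⟨by_contra fun hs => hxI ((I.toSubmodule.smul_mem_iff hs).mp hst), ht⟩
  obtain ⟨g, hg⟩ := hplu
  constructor
  · intro x y hx hxI _ _ _ σ a₀ b₀ hσ hab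
    refine (hadapted x hx hxI (σ * b₀) ?_).neg_of_isPluriclosed huni g hg
    obtain ⟨hra, hJr⟩ := (hI _).mp hab
    have hJrI : J (⁅J x, x⁆ - (a₀ • x + b₀ • y)) ∈ I :=
      (hI _).mpr ⟨hJr, by rw [hJ.1]; exact neg_mem hra⟩
    have heq : ⁅J x, J ⁅J x, x⁆⁆ - (σ * b₀) • J x =
        b₀ • (⁅J x, J y⁆ - σ • J x) + ⁅J x, J (⁅J x, x⁆ - (a₀ • x + b₀ • y))⁆ := by
      simp only [map_sub, map_add, map_smul, lie_sub, lie_add, lie_smul, lie_self]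
      module
    rw [heq]
    exact add_mem (I.smul_mem b₀ hσ) (lie_mem_right ℝ L I (J x) _ hJrI)
  · rintro ⟨g', hg'⟩
    obtain ⟨x, hx, hxI⟩ : ∃ x ∈ bb, x ∉ I := by
      by_contra! hbI
      refine hgen fun u hu v hv => ?_
      rw [habel _ ((hI u).mp (hbI u hu)).2 _ (hba hv)]
      exact zero_mem _
    have hy : ⁅J x, x⁆ ∈ a := lie_mem_right ℝ L a _ _ (hba hx)
    have hintegrable := hJ.2 x ⁅J x, x⁆
    rw [habel x (hba hx) _ hy, zero_sub, add_assoc, ← map_add, neg_add_eq_zero] at hintegrable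
    have hw : ⁅J x, ⁅J x, x⁆⁆ + ⁅x, J ⁅J x, x⁆⁆ ∈ bb := by
      rw [hbb, ha']
      refine ⟨add_mem (lie_mem_right ℝ L a _ _ hy) (lie_mem_left ℝ L a _ _ (hba hx)),
        -⁅J x, J ⁅J x, x⁆⁆, Submodule.mem_sup_right (neg_mem (Submodule.subset_span ⟨_, _, rfl⟩)),
        ?_⟩
      rw [map_neg, hintegrable, hJ.1, neg_neg]
    rw [← eq_sup_span_of_generic hIa hIb hba hgen hx hxI] at hw
    obtain ⟨u, hu, w, hw, huw⟩ := Submodule.mem_sup.mp hw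
    obtain ⟨σ, rfl⟩ := Submodule.mem_span_singleton.mp hw
    have hA : IsAdapted a I J x σ := by
      refine hadapted x hx hxI σ ?_
      rw [hintegrable, ← huw, map_add, map_smul, add_sub_cancel_right]
      obtain ⟨hua, hJu⟩ := (hI u).mp hu
      exact (hI _).mpr ⟨hJu, by rw [hJ.1]; exact neg_mem hua⟩
    exact hA.not_isBalanced huni (hA.neg_of_isPluriclosed huni g hg) hdim g' hg'
end

section
/- Let g be a finite-dimensional unimodular real Lie algebra of dimension 2n containing an abelian ideal a of codimension 2 with [g,g] ⊆ a, and J a complex structure on g with J(a) ≠ a. Let ⟨·,·⟩ be a balanced Hermitian metric on (g,J), and let {x, y} be an orthonormal basis of the orthogonal complement of a_J in a whose associated constants satisfy a + d = 0 (such a choice exists). Then a = d = c' = 0 and c = d' = −b. In particular ad − bc = b² ≥ 0, and the dimension of ([g,g] + a_J)/a_J is either 0 or 2 (it is 2 exactly when b ≠ 0). -/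
open Module

section Helpers

/-- Adjoining two vectors independent modulo `S` raises the dimension by two. -/
lemma Submodule.finrank_sup_span_pair {V : Type*} [AddCommGroup V] [Module ℝ V]
    [FiniteDimensional ℝ V] (S : Submodule ℝ V) (x y : V)
    (h : ∀ s t : ℝ, s • x + t • y ∈ S → s = 0 ∧ t = 0) :
    finrank ℝ ↥(S ⊔ Submodule.span ℝ {x, y}) = finrank ℝ ↥S + 2 := by
  have hli : LinearIndependent ℝ ![x, y] :=
    LinearIndependent.pair_iff.2 fun s t hst => h s t (hst ▸ S.zero_mem)
  have hspan : finrank ℝ ↥(Submodule.span ℝ {x, y}) = 2 := by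
    rw [← Matrix.range_cons_cons_empty x y ![]]
    exact (finrank_span_eq_card hli).trans (Fintype.card_fin 2)
  have hinf : S ⊓ Submodule.span ℝ {x, y} = ⊥ := by
    rw [eq_bot_iff]
    rintro z ⟨hzS, hz⟩
    obtain ⟨s, t, rfl⟩ := Submodule.mem_span_pair.1 hz
    obtain ⟨rfl, rfl⟩ := h s t hzS
    simp
  have := Submodule.finrank_sup_add_finrank_inf_eq S (Submodule.span ℝ {x, y})
  rw [hinf, hspan, finrank_bot] at this
  simpa using this

variable {L : Type*} [LieRing L] [LieAlgebra ℝ L] {J : L →ₗ[ℝ] L}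

namespace HermMetric

lemma exists_orthonormal_basis [FiniteDimensional ℝ L] (g : HermMetric J) {m : ℕ}
    (hm : finrank ℝ L = m) :
    ∃ f : Basis (Fin m) ℝ L, ∀ i j, g.B (f i) (f j) = if i = j then 1 else 0 := by
  let core : InnerProductSpace.Core ℝ L :=
    { inner := fun u v => g.B u v
      conj_inner_symm := fun u v => g.symm v u
      re_inner_nonneg := fun u => by
        rcases eq_or_ne u 0 with rfl | hu
        · simp
        · exact (g.posdef u hu).le
      add_left := fun u v w => by simp
      smul_left := fun u v r => by simp
      definite := fun u hu => by
        by_contra hne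
        exact (g.posdef u hne).ne' hu }
  let : NormedAddCommGroup L := core.toNormedAddCommGroup
  let : InnerProductSpace ℝ L := InnerProductSpace.ofCore core.toCore
  refine ⟨((stdOrthonormalBasis ℝ L).reindex (finCongr hm)).toBasis, fun i j => ?_⟩
  have := orthonormal_iff_ite.1
    ((stdOrthonormalBasis ℝ L).reindex (finCongr hm)).orthonormal i j
  rw [OrthonormalBasis.coe_toBasis]
  exact this

variable {ι : Type*} [Fintype ι] [DecidableEq ι]

lemma repr_eq (g : HermMetric J) (f : Basis ι ℝ L)
    (hf : ∀ i j, g.B (f i) (f j) = if i = j then 1 else 0) (v : L) (k : ι) :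
    f.repr v k = g.B (f k) v := by
  conv_rhs => rw [← f.sum_repr v, map_sum]
  simp [hf]

lemma sum_mul (g : HermMetric J) (f : Basis ι ℝ L)
    (hf : ∀ i j, g.B (f i) (f j) = if i = j then 1 else 0) (u v : L) :
    ∑ k, g.B (f k) u * g.B (f k) v = g.B u v := by
  conv_rhs => rw [← f.sum_repr u]
  simp [g.repr_eq f hf]

lemma trace_eq_sum (g : HermMetric J) (f : Basis ι ℝ L)
    (hf : ∀ i j, g.B (f i) (f j) = if i = j then 1 else 0) (T : L →ₗ[ℝ] L) :
    LinearMap.trace ℝ L T = ∑ k, g.B (f k) (T (f k)) := by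
  rw [LinearMap.trace_eq_matrix_trace ℝ f, Matrix.trace]
  simp [LinearMap.toMatrix_apply, g.repr_eq f hf]

lemma B_map_left (g : HermMetric J) (hJ : ∀ x, J (J x) = -x) (u v : L) :
    g.B (J u) v = - g.B u (J v) := by
  rw [← g.compat (J u) v, hJ]
  simp

lemma B_map_self (g : HermMetric J) (hJ : ∀ x, J (J x) = -x) (u : L) :
    g.B (J u) u = 0 := by
  have h1 := g.B_map_left hJ u u
  have h2 := g.symm (J u) u
  linarith

/-- On a unimodular Lie algebra, balancedness forces `∑ [fₖ, J fₖ] = 0`. -/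
lemma IsBalanced.sum_lie_eq_zero_s16 {g : HermMetric J} {n : ℕ} (hbal : g.IsBalanced n)
    (hJ : ∀ x, J (J x) = -x) (huni : IsUnimodularLie L) (f : Basis (Fin (2 * n)) ℝ L)
    (hf : ∀ i j, g.B (f i) (f j) = if i = j then 1 else 0) :
    ∑ k, ⁅f k, J (f k)⁆ = 0 := by
  have := Module.Finite.of_basis f
  have key : ∀ z, g.B (J (∑ k, ⁅f k, J (f k)⁆)) z = 0 := by
    intro z
    have hb := hbal f hf z
    have t1 : ∑ k, g.B (f k) ⁅z, f k⁆ = 0 := by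
      rw [← huni z, g.trace_eq_sum f hf]
      rfl
    have t2 : ∑ k, g.B (f k) (J ⁅z, J (f k)⁆) = 0 := by
      have e := g.trace_eq_sum f hf (J ∘ₗ (LieAlgebra.ad ℝ L z ∘ₗ J))
      rw [LinearMap.trace_comp_comm', LinearMap.comp_assoc,
        show J ∘ₗ J = -LinearMap.id from LinearMap.ext hJ] at e
      rw [LinearMap.comp_neg, map_neg, LinearMap.comp_id, huni z] at e
      simpa using e.symm
    have hterm : ∀ k, g.dOmega (f k) (J (f k)) z
        = - g.B (J ⁅f k, J (f k)⁆) z - g.B (f k) ⁅z, f k⁆ + g.B (f k) (J ⁅z, J (f k)⁆) := by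
      intro k
      simp only [dOmega, omega]
      rw [g.compat, ← lie_skew (f k) z, ← lie_skew (J (f k)) z, g.symm _ (f k), g.symm _ (f k)]
      simp only [map_neg]
      ring
    simp only [hterm, Finset.sum_add_distrib, Finset.sum_sub_distrib, t1, t2,
      Finset.sum_neg_distrib] at hb
    simp only [map_sum, LinearMap.sum_apply]
    linarith
  have h0 : J (∑ k, ⁅f k, J (f k)⁆) = 0 := by
    by_contra hne
    exact (g.posdef _ hne).ne' (key _)
  have := hJ (∑ k, ⁅f k, J (f k)⁆)
  rw [h0, map_zero] at this
  exact neg_eq_zero.1 this.symm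

end HermMetric

/-- The value of `φ [v, J v]` for `v = p x + q y + r Jx + w Jy + u`, when `φ` vanishes on the
brackets of `Jx` and `Jy` with `u`, `Ju` and each other. -/
lemma map_lie_self_J (hJ : ∀ x, J (J x) = -x) (φ : L →ₗ[ℝ] ℝ) {x y u : L}
    (hxy : ⁅x, y⁆ = 0) (hxu : ⁅x, u⁆ = 0) (hyu : ⁅y, u⁆ = 0)
    (hxu' : ⁅x, J u⁆ = 0) (hyu' : ⁅y, J u⁆ = 0) (huu : ⁅u, J u⁆ = 0)
    {α β γ : ℝ} (h1 : φ ⁅J x, x⁆ = α) (h2 : φ ⁅J x, y⁆ = β) (h2' : φ ⁅J y, x⁆ = β)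
    (h3 : φ ⁅J y, y⁆ = γ) (hJJ : φ ⁅J x, J y⁆ = 0)
    (h4 : φ ⁅J x, u⁆ = 0) (h5 : φ ⁅J y, u⁆ = 0)
    (h4' : φ ⁅J x, J u⁆ = 0) (h5' : φ ⁅J y, J u⁆ = 0) (p q r w : ℝ) :
    φ ⁅p • x + q • y + r • J x + w • J y + u, J (p • x + q • y + r • J x + w • J y + u)⁆
      = -((p ^ 2 + r ^ 2) * α + 2 * (p * q + r * w) * β + (q ^ 2 + w ^ 2) * γ) := by
  have s1 : φ ⁅x, J x⁆ = -α := by rw [← lie_skew, map_neg, h1]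
  have s2 : φ ⁅y, J x⁆ = -β := by rw [← lie_skew, map_neg, h2]
  have s2' : φ ⁅x, J y⁆ = -β := by rw [← lie_skew, map_neg, h2']
  have s3 : φ ⁅y, J y⁆ = -γ := by rw [← lie_skew, map_neg, h3]
  have s4 : φ ⁅u, J x⁆ = 0 := by rw [← lie_skew, map_neg, h4, neg_zero]
  have s5 : φ ⁅u, J y⁆ = 0 := by rw [← lie_skew, map_neg, h5, neg_zero]
  have s6 : φ ⁅J y, J x⁆ = 0 := by rw [← lie_skew, map_neg, hJJ, neg_zero]
  have hyx : ⁅y, x⁆ = 0 := by rw [← lie_skew, hxy, neg_zero]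
  have hux : ⁅u, x⁆ = 0 := by rw [← lie_skew, hxu, neg_zero]
  have huy : ⁅u, y⁆ = 0 := by rw [← lie_skew, hyu, neg_zero]
  simp only [map_add, map_smul, hJ, lie_add, add_lie, lie_smul, smul_lie, lie_neg, smul_neg,
    map_neg, smul_eq_mul, h1, h2, h2', h3, hJJ, h4', h5', s1, s2, s2', s3, s4, s5, s6,
    hxy, hyx, hxu', hyu', huu, hux, huy, lie_self, map_zero]
  ring

/-- If `f = p x + q y + r Jx + w Jy + u` with `u ⟂ x, y, Jx, Jy`, summing the quadratic form
`φ [v, J v]` over an orthonormal basis only sees the diagonal coefficients. -/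
lemma HermMetric.add_eq_zero_of_sum_lie_eq_zero {ι : Type*} [Fintype ι] [DecidableEq ι]
    (g : HermMetric J) (hJ : ∀ x, J (J x) = -x) (f : Basis ι ℝ L)
    (hf : ∀ i j, g.B (f i) (f j) = if i = j then 1 else 0)
    (φ : L →ₗ[ℝ] ℝ) (hφ : φ (∑ k, ⁅f k, J (f k)⁆) = 0) {x y : L}
    (hxx : g.B x x = 1) (hyy : g.B y y = 1) (hxy : g.B x y = 0) (hJxy : x + g.B (J x) y • J y ≠ 0)
    {α β γ : ℝ}
    (hdec : ∀ v : L, ∃ p q r w : ℝ, ∃ u : L, v = p • x + q • y + r • J x + w • J y + u ∧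
      g.B u x = 0 ∧ g.B u y = 0 ∧ g.B u (J x) = 0 ∧ g.B u (J y) = 0 ∧
      φ ⁅v, J v⁆ = -((p ^ 2 + r ^ 2) * α + 2 * (p * q + r * w) * β + (q ^ 2 + w ^ 2) * γ)) :
    α + γ = 0 := by
  set t := g.B (J x) y with ht
  have hyx : g.B y x = 0 := by rw [g.symm, hxy]
  have b1 : g.B (J x) x = 0 := g.B_map_self hJ x
  have b2 : g.B (J y) y = 0 := g.B_map_self hJ y
  have b3 : g.B x (J x) = 0 := by rw [g.symm, b1]
  have b4 : g.B y (J y) = 0 := by rw [g.symm, b2]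
  have b5 : g.B y (J x) = t := g.symm _ _
  have b6 : g.B x (J y) = -t := by rw [ht, g.B_map_left hJ x y, neg_neg]
  have b7 : g.B (J y) x = -t := by rw [g.symm, b6]
  have hpos : 0 < 1 - t ^ 2 := by
    have := g.posdef _ hJxy
    simp only [map_add, map_smul, LinearMap.add_apply, LinearMap.smul_apply, smul_eq_mul,
      g.compat, hxx, hyy, b6, b7] at this
    linarith
  set X := x + t • J y with hX
  set Y := y - t • J x with hY
  have hXX : g.B X X = 1 - t ^ 2 := by
    simp only [hX, map_add, map_smul, LinearMap.add_apply, LinearMap.smul_apply, smul_eq_mul,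
      g.compat, hxx, hyy, b6, b7]
    ring
  have hYY : g.B Y Y = 1 - t ^ 2 := by
    simp only [hY, map_sub, map_smul, LinearMap.sub_apply, LinearMap.smul_apply, smul_eq_mul,
      g.compat, hxx, hyy, b5, ← ht]
    ring
  have hXY : g.B X Y = 0 := by
    simp only [hX, hY, map_add, map_sub, map_smul, LinearMap.add_apply,
      LinearMap.smul_apply, smul_eq_mul, g.compat, hxy, hyx, b2, b3]
    ring
  have hterm : ∀ k, (1 - t ^ 2) ^ 2 * φ ⁅f k, J (f k)⁆ =
      -((g.B (f k) X * g.B (f k) X + g.B (f k) (J X) * g.B (f k) (J X)) * α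
        + 2 * (g.B (f k) X * g.B (f k) Y + g.B (f k) (J X) * g.B (f k) (J Y)) * β
        + (g.B (f k) Y * g.B (f k) Y + g.B (f k) (J Y) * g.B (f k) (J Y)) * γ) := by
    intro k
    obtain ⟨p, q, r, w, u, hv, u1, u2, u3, u4, hval⟩ := hdec (f k)
    have e1 : g.B (f k) X = (1 - t ^ 2) * p := by
      simp only [hv, hX, map_add, map_smul, LinearMap.add_apply, LinearMap.smul_apply, smul_eq_mul,
        g.compat, hxx, hxy, hyx, hyy, b1, b4, b6, b7, u1, u4]
      ring
    have e2 : g.B (f k) Y = (1 - t ^ 2) * q := by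
      simp only [hv, hY, map_add, map_sub, map_smul, LinearMap.add_apply, LinearMap.smul_apply,
        smul_eq_mul, g.compat, hxx, hxy, hyx, hyy, b2, b3, b5, u2, u3, ← ht]
      ring
    have e3 : g.B (f k) (J X) = (1 - t ^ 2) * r := by
      simp only [hv, hX, map_add, map_neg, map_smul, LinearMap.add_apply, LinearMap.smul_apply, hJ,
        smul_eq_mul, g.compat, hxx, hxy, hyx, hyy, b2, b3, b5, u2, u3, ← ht]
      ring
    have e4 : g.B (f k) (J Y) = (1 - t ^ 2) * w := by
      simp only [hv, hY, map_add, map_sub, map_neg, map_smul, LinearMap.add_apply,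
        LinearMap.smul_apply, hJ,
        smul_eq_mul, g.compat, hxx, hxy, hyx, hyy, b1, b4, b6, b7, u1, u4]
      ring
    rw [hval, e1, e2, e3, e4]
    ring
  have hsum : ∑ k, (1 - t ^ 2) ^ 2 * φ ⁅f k, J (f k)⁆ = 0 := by
    rw [← Finset.mul_sum, ← map_sum, hφ, mul_zero]
  simp only [hterm, Finset.sum_neg_distrib, Finset.sum_add_distrib, ← Finset.sum_mul,
    ← Finset.mul_sum, g.sum_mul f hf, g.compat, hXX, hYY, hXY] at hsum
  have : (2 * (1 - t ^ 2)) * (α + γ) = 0 := by linarith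
  exact (mul_eq_zero.1 this).resolve_left (by positivity)

end Helpers

theorem stmt16
    {L : Type*} [LieRing L] [LieAlgebra ℝ L] [FiniteDimensional ℝ L]
    (a : LieIdeal ℝ L)
    (habel : ∀ u ∈ a.toSubmodule, ∀ v ∈ a.toSubmodule, ⁅u, v⁆ = (0 : L))
    (hcodim : finrank ℝ ↥a.toSubmodule + 2 = finrank ℝ L)
    (J : L →ₗ[ℝ] L) (hJ : IsComplexStructure J)
    (huni : IsUnimodularLie L)
    (n : ℕ) (hdim : finrank ℝ L = 2 * n)
    (hcomm : ∀ u v : L, ⁅u, v⁆ ∈ a.toSubmodule)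
    (hJa : a.toSubmodule.map J ≠ a.toSubmodule)
    (aJ : Submodule ℝ L)
    (haJ : aJ = a.toSubmodule ⊓ a.toSubmodule.map J)
    (W : Submodule ℝ L)
    (hW : W = Submodule.span ℝ {z : L | ∃ u v : L, ⁅u, v⁆ = z} ⊔ aJ)
    (g : HermMetric J) (hbal : g.IsBalanced n)
    (x y : L) (hx : x ∈ a.toSubmodule) (hy : y ∈ a.toSubmodule)
    (hspanx : a.toSubmodule = aJ ⊔ Submodule.span ℝ {x} ⊔ Submodule.span ℝ {y})
    (hindepx : ∀ (s t : ℝ) (u : L), u ∈ aJ → s • x + t • y + u = 0 → s = 0 ∧ t = 0)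
    (hxx : g.B x x = 1) (hyy : g.B y y = 1) (hxy : g.B x y = 0)
    (horth : ∀ u ∈ aJ, g.B x u = 0 ∧ g.B y u = 0)
    (a₀ b₀ c₀ d₀ c' d' : ℝ)
    (h1 : ⁅J x, x⁆ - (a₀ • x + b₀ • y) ∈ aJ)
    (h2 : ⁅J x, y⁆ - (c₀ • x + d₀ • y) ∈ aJ)
    (h3 : ⁅J y, y⁆ - (c' • x + d' • y) ∈ aJ)
    (htr : a₀ + d₀ = 0) :
    a₀ = 0 ∧ d₀ = 0 ∧ c' = 0 ∧ c₀ = -b₀ ∧ d' = -b₀ ∧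
    a₀ * d₀ - b₀ * c₀ = b₀ ^ 2 ∧
    (finrank ℝ ↥W = finrank ℝ ↥aJ ∨ finrank ℝ ↥W = finrank ℝ ↥aJ + 2) ∧
    (finrank ℝ ↥W = finrank ℝ ↥aJ + 2 ↔ b₀ ≠ 0) := by
  obtain ⟨hJ2, hint⟩ := hJ
  set A := a.toSubmodule with hA
  have haJA : ∀ u ∈ aJ, u ∈ A := fun u hu => (haJ ▸ hu : u ∈ A ⊓ A.map J).1
  have mem_aJ : ∀ u, u ∈ A → J u ∈ A → u ∈ aJ := by
    intro u hu hJu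
    rw [haJ]
    exact ⟨hu, -J u, A.neg_mem hJu, by rw [map_neg, hJ2, neg_neg]⟩
  have hJaJ : ∀ u ∈ aJ, J u ∈ aJ := by
    intro u hu
    obtain ⟨huA, v, hv, rfl⟩ := (haJ ▸ hu : u ∈ A ⊓ A.map J)
    refine mem_aJ _ ?_ ?_
    · rw [hJ2]; exact A.neg_mem hv
    · rw [hJ2]; exact A.neg_mem huA
  have hind : ∀ s t : ℝ, s • x + t • y ∈ aJ → s = 0 ∧ t = 0 := fun s t h =>
    hindepx s t _ (aJ.neg_mem h) (add_neg_cancel _)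
  have hAspan : A = aJ ⊔ Submodule.span ℝ {x, y} := by
    rw [hspanx, sup_assoc, Submodule.span_insert]
  have hAdim : finrank ℝ ↥A = finrank ℝ ↥aJ + 2 := by
    rw [hAspan]; exact aJ.finrank_sup_span_pair x y hind
  have htop : A ⊔ Submodule.span ℝ {J x, J y} = ⊤ := by
    refine Submodule.eq_top_of_finrank_eq ?_
    rw [← hcodim]
    refine A.finrank_sup_span_pair _ _ fun s t h => hind s t (mem_aJ _ ?_ ?_)
    · exact A.add_mem (A.smul_mem _ hx) (A.smul_mem _ hy)
    · simpa using h
  have hdecA : ∀ v ∈ A, ∃ p q : ℝ, ∃ u ∈ aJ, v = p • x + q • y + u := by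
    intro v hv
    rw [hAspan] at hv
    obtain ⟨u, hu, z, hz, rfl⟩ := Submodule.mem_sup.1 hv
    obtain ⟨p, q, rfl⟩ := Submodule.mem_span_pair.1 hz
    exact ⟨p, q, u, hu, add_comm _ _⟩
  have hdecL : ∀ v : L, ∃ r w : ℝ, ∃ z ∈ A, v = z + r • J x + w • J y := by
    intro v
    obtain ⟨u, hu, z, hz, rfl⟩ := Submodule.mem_sup.1 (htop ▸ Submodule.mem_top : v ∈ _)
    obtain ⟨p, q, rfl⟩ := Submodule.mem_span_pair.1 hz
    exact ⟨p, q, u, hu, (add_assoc _ _ _).symm⟩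
  have hadJ : ∀ z ∈ A, ∀ u ∈ aJ, ⁅J z, u⁆ ∈ aJ := by
    intro z hz u hu
    have h := hint z u
    rw [habel z hz u (haJA u hu), habel z hz (J u) (haJA _ (hJaJ u hu)), map_zero, zero_sub,
      add_zero, neg_add_eq_zero] at h
    exact mem_aJ _ (hcomm _ _) (h ▸ hcomm _ _)
  have hJxJy' : J (⁅J x, y⁆ - ⁅J y, x⁆) = ⁅J x, J y⁆ := by
    have h := hint x y
    rw [habel x hx y hy, ← lie_skew x (J y), zero_sub, map_neg] at h
    rw [map_sub, ← sub_eq_zero, ← h]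
    abel
  have hdiff : ⁅J x, y⁆ - ⁅J y, x⁆ ∈ aJ :=
    mem_aJ _ (A.sub_mem (hcomm _ _) (hcomm _ _)) (hJxJy' ▸ hcomm _ _)
  have hJxJy : ⁅J x, J y⁆ ∈ aJ := hJxJy' ▸ hJaJ _ hdiff
  have h2' : ⁅J y, x⁆ - (c₀ • x + d₀ • y) ∈ aJ := by
    have := aJ.sub_mem h2 hdiff
    convert this using 1
    abel
  have hyx : g.B y x = 0 := by rw [g.symm, hxy]
  have valx : ∀ {v : L} {s t : ℝ}, v - (s • x + t • y) ∈ aJ → g.B x v = s := by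
    intro v s t h
    have := (horth _ h).1
    simp only [map_sub, map_add, map_smul, smul_eq_mul, hxx, hxy] at this
    linarith
  have valy : ∀ {v : L} {s t : ℝ}, v - (s • x + t • y) ∈ aJ → g.B y v = t := by
    intro v s t h
    have := (horth _ h).2
    simp only [map_sub, map_add, map_smul, smul_eq_mul, hyy, hyx] at this
    linarith
  obtain ⟨f, hf⟩ := g.exists_orthonormal_basis hdim
  have hsum := hbal.sum_lie_eq_zero_s16 hJ2 huni f hf
  have hne : x + g.B (J x) y • J y ≠ 0 := by
    intro h0
    have hJ0 := congrArg J h0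
    simp only [map_add, map_smul, hJ2, map_zero] at hJ0
    have hmem : J x ∈ A := by
      rw [eq_neg_of_add_eq_zero_left hJ0]
      exact A.neg_mem (A.smul_mem _ (A.neg_mem hy))
    have h10 := hind 1 0 (by simpa using mem_aJ x hx hmem)
    exact one_ne_zero h10.1
  have main : ∀ (φ : L →ₗ[ℝ] ℝ) (α β γ : ℝ), (∀ u ∈ aJ, φ u = 0) → φ ⁅J x, x⁆ = α →
      φ ⁅J x, y⁆ = β → φ ⁅J y, x⁆ = β → φ ⁅J y, y⁆ = γ → α + γ = 0 := by
    intro φ α β γ hφ0 e1 e2 e2' e3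
    refine g.add_eq_zero_of_sum_lie_eq_zero (β := β) hJ2 f hf φ (by rw [hsum, map_zero])
      hxx hyy hxy hne fun v => ?_
    obtain ⟨r, w, z, hz, rfl⟩ := hdecL v
    obtain ⟨p, q, u, hu, rfl⟩ := hdecA z hz
    have hu' := hJaJ u hu
    have huA := haJA u hu
    have huA' := haJA _ hu'
    refine ⟨p, q, r, w, u, by abel, by rw [g.symm]; exact (horth u hu).1,
      by rw [g.symm]; exact (horth u hu).2, ?_, ?_, ?_⟩
    · rw [g.symm, g.B_map_left hJ2, (horth _ hu').1, neg_zero]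
    · rw [g.symm, g.B_map_left hJ2, (horth _ hu').2, neg_zero]
    · rw [show p • x + q • y + u + r • J x + w • J y = p • x + q • y + r • J x + w • J y + u by abel]
      exact map_lie_self_J hJ2 φ (habel x hx y hy) (habel x hx u huA) (habel y hy u huA)
        (habel x hx _ huA') (habel y hy _ huA') (habel u huA _ huA') e1 e2 e2' e3
        (hφ0 _ hJxJy) (hφ0 _ (hadJ x hx u hu)) (hφ0 _ (hadJ y hy u hu))
        (hφ0 _ (hadJ x hx _ hu')) (hφ0 _ (hadJ y hy _ hu')) p q r w
  have hac : a₀ + c' = 0 := main (g.B x) _ c₀ _ (fun u hu => (horth u hu).1)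
    (valx h1) (valx h2) (valx h2') (valx h3)
  have hbd : b₀ + d' = 0 := main (g.B y) _ d₀ _ (fun u hu => (horth u hu).2)
    (valy h1) (valy h2) (valy h2') (valy h3)
  have hJac : ∀ z ∈ A, ⁅J x, ⁅J y, z⁆⁆ = ⁅J y, ⁅J x, z⁆⁆ := by
    intro z hz
    rw [leibniz_lie, habel _ (haJA _ hJxJy) z hz, zero_add]
  have lieval : ∀ {z v : L} {s t α β γ δ : ℝ}, z ∈ A → v - (s • x + t • y) ∈ aJ →
      ⁅J z, x⁆ - (α • x + β • y) ∈ aJ → ⁅J z, y⁆ - (γ • x + δ • y) ∈ aJ →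
      ⁅J z, v⁆ - ((s * α + t * γ) • x + (s * β + t * δ) • y) ∈ aJ := by
    intro z v s t α β γ δ hz hv k1 k2
    have := aJ.add_mem (hadJ z hz _ hv) (aJ.add_mem (aJ.smul_mem s k1) (aJ.smul_mem t k2))
    convert this using 1
    simp only [lie_sub, lie_add, lie_smul]
    module
  have kx1 := lieval hx h2' h1 h2
  have kx2 := lieval hy h1 h2' h3
  have ky1 := lieval hx h3 h1 h2
  have ky2 := lieval hy h2 h2' h3
  rw [hJac x hx] at kx1
  rw [hJac y hy] at ky1
  have E1 := (valx kx1).symm.trans (valx kx2)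
  have E2 := (valy kx1).symm.trans (valy kx2)
  have E3 := (valx ky1).symm.trans (valx ky2)
  obtain rfl : d₀ = -a₀ := by linarith
  obtain rfl : c' = -a₀ := by linarith
  obtain rfl : d' = -b₀ := by linarith
  have ha0 : a₀ = 0 := by
    by_contra hne0
    have hbc : c₀ = b₀ := by
      apply mul_left_cancel₀ hne0
      linarith
    subst hbc
    have : 0 < a₀ ^ 2 := by positivity
    nlinarith [sq_nonneg c₀]
  subst ha0
  have hcb : c₀ = -b₀ := by
    have : (c₀ + b₀) ^ 2 = 0 := by linarith
    have := pow_eq_zero_iff (two_ne_zero) |>.1 this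
    linarith
  subst hcb
  have hWb : b₀ = 0 → W = aJ := by
    rintro rfl
    simp only [neg_zero, zero_smul, add_zero, sub_zero] at h1 h2 h2' h3
    have hxA : ∀ z ∈ A, ⁅J x, z⁆ ∈ aJ := fun z hz => by
      obtain ⟨p, q, u, hu, rfl⟩ := hdecA z hz
      simp only [lie_add, lie_smul]
      exact aJ.add_mem (aJ.add_mem (aJ.smul_mem _ h1) (aJ.smul_mem _ h2)) (hadJ x hx u hu)
    have hyA : ∀ z ∈ A, ⁅J y, z⁆ ∈ aJ := fun z hz => by
      obtain ⟨p, q, u, hu, rfl⟩ := hdecA z hz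
      simp only [lie_add, lie_smul]
      exact aJ.add_mem (aJ.add_mem (aJ.smul_mem _ h2') (aJ.smul_mem _ h3)) (hadJ y hy u hu)
    rw [hW, sup_eq_right, Submodule.span_le]
    rintro _ ⟨u, v, rfl⟩
    obtain ⟨r, w, z, hz, rfl⟩ := hdecL u
    obtain ⟨r', w', z', hz', rfl⟩ := hdecL v
    have : ⁅z + r • J x + w • J y, z' + r' • J x + w' • J y⁆ =
        r • ⁅J x, z'⁆ + w • ⁅J y, z'⁆ - r' • ⁅J x, z⁆ - w' • ⁅J y, z⁆
          + (r * w' - w * r') • ⁅J x, J y⁆ := by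
      simp only [lie_add, add_lie, lie_smul, smul_lie, lie_self, habel z hz z' hz',
        ← lie_skew z (J x), ← lie_skew z (J y), ← lie_skew (J y) (J x)]
      module
    rw [this]
    exact aJ.add_mem (aJ.sub_mem (aJ.sub_mem (aJ.add_mem (aJ.smul_mem _ (hxA _ hz'))
      (aJ.smul_mem _ (hyA _ hz'))) (aJ.smul_mem _ (hxA _ hz))) (aJ.smul_mem _ (hyA _ hz)))
      (aJ.smul_mem _ hJxJy)
  have hWA : b₀ ≠ 0 → W = A := by
    intro hb
    have hlie : ∀ u v : L, ⁅u, v⁆ ∈ W := fun u v =>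
      hW ▸ Submodule.mem_sup_left (Submodule.subset_span ⟨u, v, rfl⟩)
    have haJW : aJ ≤ W := hW ▸ le_sup_right
    have hyW : y ∈ W := by
      rw [← W.smul_mem_iff hb]
      convert W.sub_mem (hlie (J x) x) (haJW h1) using 1
      module
    have hxW : x ∈ W := by
      rw [← W.smul_mem_iff (neg_ne_zero.2 hb)]
      convert W.sub_mem (hlie (J x) y) (haJW h2) using 1
      module
    apply le_antisymm
    · rw [hW, sup_le_iff, Submodule.span_le]
      refine ⟨?_, haJA⟩
      rintro _ ⟨u, v, rfl⟩
      exact hcomm u v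
    · rw [hAspan, sup_le_iff, Submodule.span_le]
      exact ⟨haJW, by simp [Set.insert_subset_iff, hxW, hyW]⟩
  refine ⟨rfl, neg_zero, neg_zero, rfl, rfl, by ring, ?_, ?_, fun hb => by rw [hWA hb, hAdim]⟩
  · by_cases hb : b₀ = 0
    · exact Or.inl (by rw [hWb hb])
    · exact Or.inr (by rw [hWA hb, hAdim])
  · intro h hb
    rw [hWb hb] at h
    omega
end
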